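/- arXiv:0705.1961 — 2 statements merged into one kernel-verified Lean document; each statement's English description precedes it below -/
import Mathlib

section
/- Let (𝔄,(A_i)_{i∈𝓛}) and (𝔅,(B_i)_{i∈𝓛}) be 𝓛-graded C*-algebras and ρ : 𝔄 → 𝔅 a *-homomorphism with ρ(A_i) ⊆ B_i for all i ∈ 𝓛; write ρ_i for its restriction to A_i. Then: (a) the kernel of ρ equals the closed linear span of ⋃_{i∈𝓛} {x ∈ A_i : ρ(x) = 0}; (b) the range of ρ equals the closed linear span of ⋃_{i∈𝓛} ρ(A_i). -/
/-- Truncating the real spectrum of a self-adjoint element by functional calculus. -/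
lemma NonUnitalStarAlgHom.exists_norm_le_of_isSelfAdjoint {A B : Type*}
    [NonUnitalCStarAlgebra A] [NonUnitalCStarAlgebra B] (φ : A →⋆ₙₐ[ℂ] B) {a : A}
    (ha : IsSelfAdjoint a) : ∃ a', φ a' = φ a ∧ ‖a'‖ ≤ ‖φ a‖ := by
  have hφ : Continuous φ :=
    AddMonoidHomClass.continuous_of_bound φ 1 fun x ↦ by
      simpa using NonUnitalStarAlgHom.norm_apply_le φ x
  have hφa : IsSelfAdjoint (φ a) := ha.map φ
  set r := ‖φ a‖ with hr
  have hr0 : 0 ≤ r := norm_nonneg _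
  let f : ℝ → ℝ := fun x ↦ max (-r) (min x r)
  have hf : Continuous f := by fun_prop
  have hf0 : f 0 = 0 := by simp [f, hr0]
  refine ⟨cfcₙ f a, ?_, ?_⟩
  · rw [NonUnitalStarAlgHom.map_cfcₙ φ f a hf.continuousOn hf0 hφ ha hφa]
    conv_rhs => rw [← cfcₙ_id ℝ (φ a) hφa]
    refine cfcₙ_congr fun x hx ↦ ?_
    have := norm_apply_le_norm_cfcₙ (id : ℝ → ℝ) (φ a) hx continuousOn_id rfl hφa
    rw [cfcₙ_id ℝ (φ a) hφa, ← hr, id, Real.norm_eq_abs, abs_le] at this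
    simp [f, this.1, this.2]
  · refine norm_cfcₙ_le fun x _ ↦ ?_
    rw [Real.norm_eq_abs, abs_le]
    exact ⟨le_max_left _ _, max_le (by linarith) (min_le_right _ _)⟩

lemma NonUnitalStarAlgHom.exists_norm_le {A B : Type*}
    [NonUnitalCStarAlgebra A] [NonUnitalCStarAlgebra B] (φ : A →⋆ₙₐ[ℂ] B) (a : A) :
    ∃ a', φ a' = φ a ∧ ‖a'‖ ≤ 2 * ‖φ a‖ := by
  obtain ⟨x, hx, hxn⟩ := φ.exists_norm_le_of_isSelfAdjoint (realPart a).2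
  obtain ⟨y, hy, hyn⟩ := φ.exists_norm_le_of_isSelfAdjoint (imaginaryPart a).2
  have hre : φ (realPart a : A) = (realPart (φ a) : B) := map_realPart φ a
  have him : φ (imaginaryPart a : A) = (imaginaryPart (φ a) : B) := map_imaginaryPart φ a
  refine ⟨x + Complex.I • y, ?_, ?_⟩
  · rw [map_add, map_smul, hx, hy, ← map_smul, ← map_add, realPart_add_I_smul_imaginaryPart]
  · have h1 := realPart.norm_le (φ a)
    have h2 := imaginaryPart.norm_le (φ a)
    rw [hre] at hxn
    rw [him] at hyn
    calc ‖x + Complex.I • y‖ ≤ ‖x‖ + ‖Complex.I • y‖ := norm_add_le _ _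
      _ = ‖x‖ + ‖y‖ := by simp [norm_smul]
      _ ≤ 2 * ‖φ a‖ := by
        have h1' : ‖(realPart (φ a) : B)‖ ≤ ‖φ a‖ := h1
        have h2' : ‖(imaginaryPart (φ a) : B)‖ ≤ ‖φ a‖ := h2
        linarith

lemma NonUnitalStarAlgHom.isClosed_range {A B : Type*}
    [NonUnitalCStarAlgebra A] [NonUnitalCStarAlgebra B] (φ : A →⋆ₙₐ[ℂ] B) :
    IsClosed (Set.range φ) := by
  let f : NormedAddGroupHom A B :=
    AddMonoidHom.mkNormedAddGroupHom (φ : A →+ B) 1 fun x ↦ by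
      simpa using NonUnitalStarAlgHom.norm_apply_le φ x
  have h : f.SurjectiveOnWith f.range 2 := by
    rintro _ ⟨x, rfl⟩
    exact φ.exists_norm_le x
  have := controlled_closure_of_complete two_pos one_pos h
  refine isClosed_of_closure_subset fun y hy ↦ ?_
  obtain ⟨x, hx, -⟩ := this y (by
    rw [← SetLike.mem_coe, AddSubgroup.topologicalClosure_coe]; exact hy)
  exact ⟨x, hx⟩

/-- The sum of a closed star subalgebra `C` and a closed star subalgebra `I` which is
absorbed by `C` and meets it trivially is again a closed star subalgebra. -/
lemma NonUnitalStarSubalgebra.exists_isClosed_add {A : Type*} [NonUnitalCStarAlgebra A]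
    (C I : NonUnitalStarSubalgebra ℂ A) (hC : IsClosed (C : Set A)) (hI : IsClosed (I : Set A))
    (hmul : ∀ c ∈ C, ∀ b ∈ I, c * b ∈ I) (hdisj : ∀ x ∈ C, x ∈ I → x = 0) :
    ∃ S : NonUnitalStarSubalgebra ℂ A, IsClosed (S : Set A) ∧
      ∀ x, x ∈ S ↔ ∃ c ∈ C, ∃ b ∈ I, x = c + b := by
  have hmul' : ∀ c ∈ C, ∀ b ∈ I, b * c ∈ I := fun c hc b hb ↦ by
    simpa using star_mem (hmul _ (star_mem hc) _ (star_mem hb))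
  let D : NonUnitalStarSubalgebra ℂ (A × A) :=
    { carrier := {p | p.1 ∈ C ∧ p.2 - p.1 ∈ I}
      add_mem' := fun {p q} hp hq ↦ ⟨add_mem hp.1 hq.1, by
        simpa [add_sub_add_comm] using add_mem hp.2 hq.2⟩
      zero_mem' := ⟨zero_mem C, by simp⟩
      mul_mem' := fun {p q} hp hq ↦ ⟨mul_mem hp.1 hq.1, by
        have : (p * q).2 - (p * q).1 =
            (p.2 - p.1) * (q.2 - q.1) + p.1 * (q.2 - q.1) + (p.2 - p.1) * q.1 := by
          simp only [Prod.fst_mul, Prod.snd_mul]; noncomm_ring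
        rw [this]
        exact add_mem (add_mem (mul_mem hp.2 hq.2) (hmul _ hp.1 _ hq.2)) (hmul' _ hq.1 _ hp.2)⟩
      smul_mem' := fun c p hp ↦ ⟨SMulMemClass.smul_mem c hp.1, by
        simpa [smul_sub] using SMulMemClass.smul_mem c hp.2⟩
      star_mem' := fun {p} hp ↦ ⟨star_mem hp.1, by simpa using star_mem hp.2⟩ }
  have hDc : IsClosed (D : Set (A × A)) :=
    (hC.preimage continuous_fst).inter (hI.preimage (continuous_snd.sub continuous_fst))
  let π : D →⋆ₙₐ[ℂ] A :=
    (NonUnitalStarAlgHom.snd ℂ A A).comp (NonUnitalStarSubalgebraClass.subtype D)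
  refine ⟨NonUnitalStarAlgHom.range π, ?_, fun x ↦ ?_⟩
  · have hπ : Function.Injective π := by
      rw [injective_iff_map_eq_zero]
      rintro ⟨⟨c, x⟩, hc, hx⟩ h0
      obtain rfl : x = 0 := h0
      have : c = 0 := hdisj c hc (by simpa using hx)
      subst this
      rfl
    exact (NonUnitalStarAlgHom.isometry π hπ).isClosedEmbedding.isClosed_range
  · rw [NonUnitalStarAlgHom.mem_range]
    constructor
    · rintro ⟨⟨⟨c, x⟩, hc, hx⟩, rfl⟩
      exact ⟨c, hc, x - c, hx, (add_sub_cancel c x).symm⟩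
    · rintro ⟨c, hc, b, hb, rfl⟩
      exact ⟨⟨(c, c + b), hc, by simpa using hb⟩, rfl⟩

/-- In a semilattice-graded C⋆-algebra, the components indexed by a finite subsemilattice sum to
a closed star subalgebra. -/
lemma exists_isClosed_starSubalgebra_sum {L : Type*} [SemilatticeInf L] {A : Type*}
    [NonUnitalCStarAlgebra A] (G : L → NonUnitalStarSubalgebra ℂ A)
    (hclosed : ∀ i, IsClosed (G i : Set A))
    (hindep : ∀ (s : Finset L) (x : L → A), (∀ i, x i ∈ G i) →
      ∑ i ∈ s, x i = 0 → ∀ i ∈ s, x i = 0)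
    (hmul : ∀ i j, ∀ x ∈ G i, ∀ y ∈ G j, x * y ∈ G (i ⊓ j))
    (F : Finset L) (hF : InfClosed (F : Set L)) :
    ∃ S : NonUnitalStarSubalgebra ℂ A, IsClosed (S : Set A) ∧
      ∀ x, x ∈ S ↔ ∃ f : L → A, (∀ i, f i ∈ G i) ∧ x = ∑ i ∈ F, f i := by
  classical
  induction F using Finset.strongInduction with
  | H F ih =>
  obtain rfl | hne := F.eq_empty_or_nonempty
  · refine ⟨⊥, by simp, fun x ↦ ?_⟩
    rw [NonUnitalStarAlgebra.mem_bot]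
    constructor
    · rintro rfl
      exact ⟨0, fun i ↦ zero_mem _, by simp⟩
    · rintro ⟨f, -, rfl⟩
      simp
  obtain ⟨m, hm⟩ := F.exists_maximal hne
  have hinf {i j : L} (hi : i ∈ F) (hj : j ∈ F.erase m) : i ⊓ j ∈ F.erase m := by
    rw [Finset.mem_erase] at hj ⊢
    refine ⟨fun h ↦ hj.1 ?_, hF hi hj.2⟩
    have hmj : m ≤ j := h ▸ inf_le_right
    exact le_antisymm (hm.2 hj.2 hmj) hmj
  obtain ⟨I, hI, hmem⟩ := ih (F.erase m) (Finset.erase_ssubset hm.1) fun i hi j hj ↦ by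
    exact hinf (Finset.mem_of_mem_erase hi) hj
  have hGI {j : L} (hj : j ∈ F.erase m) {y : A} (hy : y ∈ G j) : y ∈ I := by
    refine (hmem y).2 ⟨Pi.single j y, fun i ↦ ?_, ?_⟩
    · obtain rfl | h := eq_or_ne i j
      · simpa
      · simp [h]
    · rw [Finset.sum_pi_single', if_pos hj]
  obtain ⟨S, hS, hS'⟩ := (G m).exists_isClosed_add I (hclosed m) hI
    (fun c hc b hb ↦ by
      obtain ⟨f, hf, rfl⟩ := (hmem b).1 hb
      rw [Finset.mul_sum]
      exact sum_mem fun j hj ↦ hGI (hinf hm.1 hj) (hmul _ _ _ hc _ (hf j)))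
    (fun x hx hxI ↦ by
      obtain ⟨f, hf, hxf⟩ := (hmem x).1 hxI
      have := hindep F (Function.update f m (-x)) (fun i ↦ by
        obtain rfl | h := eq_or_ne i m
        · simpa using hx
        · simpa [h] using hf i) (by
        rw [← Finset.add_sum_erase F _ hm.1, Function.update_self,
          Finset.sum_congr rfl fun i hi ↦ Function.update_of_ne (Finset.ne_of_mem_erase hi) _ _,
          ← hxf, neg_add_cancel]) m hm.1
      simpa using this)
  refine ⟨S, hS, fun x ↦ (hS' x).trans ⟨?_, ?_⟩⟩
  · rintro ⟨c, hc, b, hb, rfl⟩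
    obtain ⟨f, hf, rfl⟩ := (hmem b).1 hb
    refine ⟨Function.update f m c, fun i ↦ ?_, ?_⟩
    · obtain rfl | h := eq_or_ne i m
      · simpa using hc
      · simpa [h] using hf i
    · rw [← Finset.add_sum_erase F _ hm.1, Function.update_self,
        Finset.sum_congr rfl fun i hi ↦ Function.update_of_ne (Finset.ne_of_mem_erase hi) _ _]
  · rintro ⟨f, hf, rfl⟩
    exact ⟨f m, hf m, _, (hmem _).2 ⟨f, hf, rfl⟩, (Finset.add_sum_erase F f hm.1).symm⟩

/-- An element of the span of a family of subspaces is a sum over a finite subsemilattice. -/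
lemma exists_infClosed_finset_sum {L R M : Type*} [SemilatticeInf L] [Semiring R]
    [AddCommMonoid M] [Module R M] (p : L → Submodule R M) {y : M}
    (hy : y ∈ Submodule.span R (⋃ i, (p i : Set M))) :
    ∃ F : Finset L, InfClosed (F : Set L) ∧
      ∃ f : L → M, (∀ i, f i ∈ p i) ∧ y = ∑ i ∈ F, f i := by
  classical
  rw [← Submodule.iSup_eq_span, Submodule.mem_iSup_iff_exists_finsupp] at hy
  obtain ⟨f, hf, rfl⟩ := hy
  have hfin : (infClosure (f.support : Set L)).Finite := f.support.finite_toSet.infClosure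
  refine ⟨hfin.toFinset, by simp, f, hf, ?_⟩
  refine Finset.sum_subset (fun i hi ↦ ?_) fun i _ hi ↦ by simpa using hi
  rw [Set.Finite.mem_toFinset]
  exact subset_infClosure hi


theorem stmt_12
    {𝓛 : Type*} [SemilatticeInf 𝓛]
    {𝔄 : Type*} [NonUnitalNormedRing 𝔄] [StarRing 𝔄] [CStarRing 𝔄]
    [NormedSpace ℂ 𝔄] [IsScalarTower ℂ 𝔄 𝔄] [SMulCommClass ℂ 𝔄 𝔄]
    [StarModule ℂ 𝔄] [CompleteSpace 𝔄]
    {𝔅 : Type*} [NonUnitalNormedRing 𝔅] [StarRing 𝔅] [CStarRing 𝔅]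
    [NormedSpace ℂ 𝔅] [IsScalarTower ℂ 𝔅 𝔅] [SMulCommClass ℂ 𝔅 𝔅]
    [StarModule ℂ 𝔅] [CompleteSpace 𝔅]
    (A : 𝓛 → NonUnitalStarSubalgebra ℂ 𝔄)
    (hA_closed : ∀ i : 𝓛, IsClosed ((A i : Set 𝔄)))
    (hA_indep : ∀ (s : Finset 𝓛) (x : 𝓛 → 𝔄), (∀ i, x i ∈ A i) →
        ∑ i ∈ s, x i = 0 → ∀ i ∈ s, x i = 0)
    (hA_total : closure ((Submodule.span ℂ (⋃ i : 𝓛, (A i : Set 𝔄)) : Submodule ℂ 𝔄) : Set 𝔄) = Set.univ)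
    (hA_mul : ∀ i j : 𝓛, ∀ x ∈ A i, ∀ y ∈ A j, x * y ∈ A (i ⊓ j))
    (B : 𝓛 → NonUnitalStarSubalgebra ℂ 𝔅)
    (hB_closed : ∀ i : 𝓛, IsClosed ((B i : Set 𝔅)))
    (hB_indep : ∀ (s : Finset 𝓛) (x : 𝓛 → 𝔅), (∀ i, x i ∈ B i) →
        ∑ i ∈ s, x i = 0 → ∀ i ∈ s, x i = 0)
    (hB_total : closure ((Submodule.span ℂ (⋃ i : 𝓛, (B i : Set 𝔅)) : Submodule ℂ 𝔅) : Set 𝔅) = Set.univ)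
    (hB_mul : ∀ i j : 𝓛, ∀ x ∈ B i, ∀ y ∈ B j, x * y ∈ B (i ⊓ j))
    (ρ : 𝔄 →⋆ₙₐ[ℂ] 𝔅) (hρ : ∀ i : 𝓛, ∀ x ∈ A i, ρ x ∈ B i) :
    ({x : 𝔄 | ρ x = 0} = closure ((Submodule.span ℂ
        (⋃ i : 𝓛, {x : 𝔄 | x ∈ A i ∧ ρ x = 0}) : Submodule ℂ 𝔄) : Set 𝔄)) ∧
    (Set.range ρ = closure ((Submodule.span ℂ
        (⋃ i : 𝓛, ρ '' (A i : Set 𝔄)) : Submodule ℂ 𝔅) : Set 𝔅)) := by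
  classical
  let : NonUnitalCStarAlgebra 𝔄 := {}
  let : NonUnitalCStarAlgebra 𝔅 := {}
  have hle : ∀ x, ‖ρ x‖ ≤ ‖x‖ := NonUnitalStarAlgHom.norm_apply_le ρ
  have hcont : Continuous ρ :=
    AddMonoidHomClass.continuous_of_bound ρ 1 fun x ↦ by simpa using hle x
  refine ⟨Set.Subset.antisymm (fun x hx ↦ ?_) ?_, Set.Subset.antisymm ?_ ?_⟩
  · rw [Metric.mem_closure_iff]
    intro ε hε
    have hx0 : ρ x = 0 := hx
    obtain ⟨y, hy, hxy⟩ := Metric.mem_closure_iff.1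
      (hA_total ▸ Set.mem_univ x : x ∈ closure _) (ε / 3) (by positivity)
    obtain ⟨F, hF, f, hf, hyf⟩ :=
      exists_infClosed_finset_sum (fun i ↦ (A i).toSubmodule) hy
    obtain ⟨S, hS, hmem⟩ :=
      exists_isClosed_starSubalgebra_sum A hA_closed hA_indep hA_mul F hF
    have hyS : y ∈ S := (hmem y).2 ⟨f, hf, hyf⟩
    obtain ⟨⟨z, hzS⟩, hz, hzn⟩ := NonUnitalStarAlgHom.exists_norm_le
      (ρ.comp (NonUnitalStarSubalgebraClass.subtype S)) ⟨y, hyS⟩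
    replace hz : ρ z = ρ y := hz
    replace hzn : ‖z‖ ≤ 2 * ‖ρ y‖ := hzn
    refine ⟨y - z, ?_, ?_⟩
    · obtain ⟨g, hg, hyz⟩ := (hmem _).1 (sub_mem hyS hzS)
      have hsum : ∑ i ∈ F, ρ (g i) = 0 := by
        rw [← map_sum, ← hyz, map_sub, hz, sub_self]
      have hzero := hB_indep F (fun i ↦ ρ (g i)) (fun i ↦ hρ i _ (hg i)) hsum
      rw [hyz]
      exact sum_mem fun i hi ↦
        Submodule.subset_span (Set.mem_iUnion.2 ⟨i, hg i, hzero i hi⟩)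
    · rw [dist_eq_norm] at hxy ⊢
      have hρy : ‖ρ y‖ ≤ ‖x - y‖ := by
        simpa [hx0] using hle (x - y)
      calc ‖x - (y - z)‖ = ‖(x - y) + z‖ := by congr 1; abel
        _ ≤ ‖x - y‖ + ‖z‖ := norm_add_le _ _
        _ < ε := by linarith
  · refine closure_minimal (fun x hx ↦ ?_) (isClosed_singleton.preimage hcont)
    refine (Submodule.span_le (p := LinearMap.ker (ρ : 𝔄 →ₗ[ℂ] 𝔅))).2 ?_ hx
    exact Set.iUnion_subset fun i x hx ↦ hx.2
  · rintro _ ⟨x, rfl⟩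
    refine closure_mono ?_ (image_closure_subset_closure_image hcont
      ⟨x, (hA_total ▸ Set.mem_univ x : x ∈ closure _), rfl⟩)
    rintro _ ⟨y, hy, rfl⟩
    refine (Submodule.span_le (p := (Submodule.span ℂ _).comap (ρ : 𝔄 →ₗ[ℂ] 𝔅))).2 ?_ hy
    exact Set.iUnion_subset fun i x hx ↦
      Submodule.subset_span (Set.mem_iUnion.2 ⟨i, x, hx, rfl⟩)
  · refine closure_minimal (fun x hx ↦ ?_) ρ.isClosed_range
    refine (Submodule.span_le (p := LinearMap.range (ρ : 𝔄 →ₗ[ℂ] 𝔅))).2 ?_ hx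
    exact Set.iUnion_subset fun i ↦ Set.image_subset_range _ _
end

section
/- Let (𝔄,(A_i)_{i∈𝓛}) be an 𝓛-graded C*-algebra and I a closed two-sided ideal of 𝔄. The following are equivalent: (a) I is a graded subalgebra, i.e. I equals the closed linear span of ⋃_{i∈𝓛} (I ∩ A_i); (b) the images of the components in the quotient 𝔄/I are linearly independent, i.e. for every finitely supported family (x_i)_{i∈𝓛} with x_i ∈ A_i, if Σ_i x_i ∈ I then x_i ∈ I for every i. -/
theorem cfcₙ_mem_of_isClosed {E : Type*} [NonUnitalCStarAlgebra E]
    {S : NonUnitalStarSubalgebra ℂ E} (hS : IsClosed (S : Set E))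
    (f : ℝ → ℝ) {a : E} (ha : a ∈ S) : cfcₙ f a ∈ S :=
  have : IsClosed (S : Set E) := hS
  cfcₙ_mem f ha

section FunctionalCalculus

variable {E : Type*} [NonUnitalCStarAlgebra E] [PartialOrder E] [StarOrderedRing E]

theorem norm_sub_cfcₙ_conjugate_le {v : E} (hv : 0 ≤ v) {f : ℝ → ℝ} (hf : Continuous f)
    (hf0 : f 0 = 0) {C : ℝ} (hC : ∀ t, 0 ≤ t → t * (1 - f t) ^ 2 ≤ C) :
    ‖v - cfcₙ f v * v - v * cfcₙ f v + cfcₙ f v * v * cfcₙ f v‖ ≤ C := by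
  have hsa : IsSelfAdjoint v := .of_nonneg hv
  have key : cfcₙ (fun t ↦ t - f t * t - t * f t + f t * t * f t) v =
      v - cfcₙ f v * v - v * cfcₙ f v + cfcₙ f v * v * cfcₙ f v := by
    rw [cfcₙ_add .., cfcₙ_sub .., cfcₙ_sub .., cfcₙ_mul .., cfcₙ_mul .., cfcₙ_mul ..,
      cfcₙ_mul .., cfcₙ_id' ..]
  rw [← key]
  refine norm_cfcₙ_le fun t ht ↦ ?_
  have ht0 : 0 ≤ t := quasispectrum_nonneg_of_nonneg v hv t ht
  have h := hC t ht0
  rw [show t - f t * t - t * f t + f t * t * f t = t * (1 - f t) ^ 2 by ring, Real.norm_eq_abs,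
    abs_of_nonneg (by positivity)]
  exact h

theorem norm_sub_mul_cfcₙ_star_mul_self_le (y : E) {f : ℝ → ℝ} (hf : Continuous f)
    (hf0 : f 0 = 0) {C : ℝ} (hC0 : 0 ≤ C) (hC : ∀ t, 0 ≤ t → t * (1 - f t) ^ 2 ≤ C ^ 2) :
    ‖y - y * cfcₙ f (star y * y)‖ ≤ C := by
  have h := norm_sub_cfcₙ_conjugate_le (star_mul_self_nonneg y) hf hf0 hC
  have hc : star (cfcₙ f (star y * y)) = cfcₙ f (star y * y) :=
    (cfcₙ_predicate (p := IsSelfAdjoint) f (star y * y)).star_eq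
  refine abs_le_of_sq_le_sq' ?_ hC0 |>.2
  rw [sq, ← CStarRing.norm_star_mul_self]
  refine (congrArg norm ?_).trans_le h
  rw [star_sub, star_mul, hc]
  noncomm_ring

theorem continuous_div_abs_add {δ : ℝ} (hδ : 0 < δ) : Continuous fun t : ℝ ↦ t / (|t| + δ) :=
  continuous_id.div (by fun_prop) fun t ↦ by positivity

theorem mul_one_sub_div_abs_add_sq_le {δ : ℝ} (hδ : 0 < δ) {t : ℝ} (ht : 0 ≤ t) :
    t * (1 - t / (|t| + δ)) ^ 2 ≤ δ := by
  rw [abs_of_nonneg ht, one_sub_div (by positivity), div_pow, mul_div_assoc',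
    div_le_iff₀ (by positivity)]
  nlinarith [mul_nonneg ht hδ.le, mul_nonneg (sq_nonneg t) hδ.le, pow_pos hδ 3,
    mul_nonneg ht (sq_nonneg δ)]

/-- A hereditary property: a positive square dominated by an element of a closed star subalgebra
which it multiplies into itself belongs to that subalgebra. -/
theorem mul_self_mem_of_le {S : NonUnitalStarSubalgebra ℂ E} (hS : IsClosed (S : Set E))
    {r v : E} (hr : IsSelfAdjoint r) (hv : v ∈ S) (hrv : r * r ≤ v)
    (hrS : ∀ x ∈ S, r * x * r ∈ S) : r * r ∈ S := by
  have hrr : 0 ≤ r * r := hr.mul_self_nonneg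
  have hv0 : 0 ≤ v := hrr.trans hrv
  have approx : ∀ δ : ℝ, 0 < δ → ∃ z ∈ S, ‖r * r - z‖ ^ 2 ≤ ‖r‖ ^ 2 * δ := by
    intro δ hδ
    set e := cfcₙ (fun t : ℝ ↦ t / (|t| + δ)) v with he_def
    have he : star e = e := (cfcₙ_predicate (p := IsSelfAdjoint) _ v).star_eq
    have heS : e ∈ S := cfcₙ_mem_of_isClosed hS _ hv
    refine ⟨r * e * r, hrS e heS, ?_⟩
    have hbound : ‖v - e * v - v * e + e * v * e‖ ≤ δ :=
      norm_sub_cfcₙ_conjugate_le hv0 (continuous_div_abs_add hδ) (by simp)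
        fun t ht ↦ mul_one_sub_div_abs_add_sq_le hδ ht
    have h1 : ‖r * r - r * e * r‖ ^ 2 = ‖star (r - e * r) * (r * r) * (r - e * r)‖ := by
      rw [sq, ← CStarRing.norm_star_mul_self]
      congr 1
      simp only [star_sub, star_mul, he, hr.star_eq]
      noncomm_ring
    have h2 : ‖star (r - e * r) * (r * r) * (r - e * r)‖ ≤
        ‖star (r - e * r) * v * (r - e * r)‖ :=
      CStarAlgebra.norm_le_norm_of_nonneg_of_le (star_left_conjugate_nonneg hrr _)
        (star_left_conjugate_le_conjugate hrv _)
    have h3 : star (r - e * r) * v * (r - e * r) = r * (v - e * v - v * e + e * v * e) * r := by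
      simp only [star_sub, star_mul, he, hr.star_eq]
      noncomm_ring
    rw [h1]
    refine h2.trans ?_
    rw [h3]
    calc _ ≤ ‖r‖ * ‖v - e * v - v * e + e * v * e‖ * ‖r‖ := norm_mul₃_le ..
      _ ≤ ‖r‖ * δ * ‖r‖ := by gcongr
      _ = _ := by ring
  rw [← SetLike.mem_coe, ← hS.closure_eq, Metric.mem_closure_iff]
  intro η hη
  obtain ⟨z, hz, hzn⟩ := approx (η ^ 2 / (‖r‖ ^ 2 + 1)) (by positivity)
  refine ⟨z, hz, ?_⟩
  rw [dist_eq_norm]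
  refine abs_lt_of_sq_lt_sq' (hzn.trans_lt ?_) hη.le |>.2
  rw [mul_div_assoc', div_lt_iff₀ (by positivity)]
  nlinarith [pow_pos hη 2]

theorem exists_mem_inf_norm_sub_le {B S : NonUnitalStarSubalgebra ℂ E}
    (hB : IsClosed (B : Set E)) (hS : IsClosed (S : Set E))
    (hl : ∀ b ∈ B, ∀ x ∈ S, b * x ∈ S) (hr : ∀ b ∈ B, ∀ x ∈ S, x * b ∈ S)
    {y w : E} (hy : y ∈ B) (hw : w ∈ S) {ε : ℝ} (hε : 0 < ε) (h : ‖y - w‖ ≤ ε) :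
    ∃ z ∈ B, z ∈ S ∧ ‖y - z‖ ≤ 2 * ε := by
  set a := star y * y with ha_def
  have haB : a ∈ B := mul_mem (star_mem hy) hy
  have ha : 0 ≤ a := star_mul_self_nonneg y
  have hsa : IsSelfAdjoint a := .of_nonneg ha
  set d := star (y - w) * (y - w) with hd_def
  have hd : IsSelfAdjoint d := .star_mul_self _
  set k := a - d with hk_def
  have hkS : k ∈ S := by
    have : k = star y * w + star w * y - star w * w := by
      simp only [hk_def, ha_def, hd_def, star_sub]; noncomm_ring
    rw [this]
    exact sub_mem (add_mem (hl _ (star_mem hy) _ hw) (hr _ hy _ (star_mem hw)))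
      (mul_mem (star_mem hw) hw)
  obtain ⟨m, hm, hm0, hm_nonneg, hm_eq⟩ : ∃ m : ℝ → ℝ, Continuous m ∧ m 0 = 0 ∧
      (∀ t, 0 ≤ m t) ∧ ∀ t, m t = max (t - ε ^ 2) 0 :=
    ⟨fun t ↦ max (t - ε ^ 2) 0, by fun_prop, max_eq_right (by nlinarith),
      fun t ↦ le_max_right _ _, fun t ↦ rfl⟩
  obtain ⟨p, hp, hp0, hpp⟩ : ∃ p : ℝ → ℝ, Continuous p ∧ p 0 = 0 ∧ ∀ t, p t * p t = m t :=
    ⟨fun t ↦ √(m t), by fun_prop, by simp [hm0], fun t ↦ Real.mul_self_sqrt (hm_nonneg t)⟩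
  have hmax : ∀ t : ℝ, max t (ε ^ 2) ≠ 0 := fun t ↦ (lt_max_of_lt_right (by positivity)).ne'
  obtain ⟨l, hlc, hl0, hl_eq⟩ : ∃ l : ℝ → ℝ, Continuous l ∧ l 0 = 0 ∧
      ∀ t, ε ^ 2 ≤ t → l t = t / t ^ 3 :=
    ⟨fun t ↦ t / max t (ε ^ 2) ^ 3, continuous_id.div (by fun_prop) fun t ↦ pow_ne_zero 3 (hmax t),
      by simp, fun t ht ↦ by beta_reduce; rw [max_eq_left ht]⟩
  set g := cfcₙ p a with hg_def
  set r := cfcₙ m a with hr_def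
  have hg : IsSelfAdjoint g := cfcₙ_predicate _ _
  have hrsa : IsSelfAdjoint r := cfcₙ_predicate _ _
  have hgB : g ∈ B := cfcₙ_mem_of_isClosed hB _ haB
  have hrB : r ∈ B := cfcₙ_mem_of_isClosed hB _ haB
  have hgg : g * g = r := by
    rw [hg_def, hr_def, ← cfcₙ_mul p p a hp.continuousOn hp0 hp.continuousOn hp0]
    exact cfcₙ_congr fun t _ ↦ hpp t
  have hgag : g * a * g = r * r + (ε ^ 2) • r := by
    have h1 : g * a * g = cfcₙ (fun t ↦ p t * t * p t) a := by
      rw [cfcₙ_mul (fun t ↦ p t * t) p a (hp.mul continuous_id).continuousOn (mul_zero _)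
        hp.continuousOn hp0, cfcₙ_mul p (fun t ↦ t) a hp.continuousOn hp0 continuousOn_id rfl,
        cfcₙ_id' ℝ a hsa]
    have h2 : r * r + (ε ^ 2) • r = cfcₙ (fun t ↦ m t * m t + ε ^ 2 * m t) a := by
      rw [cfcₙ_add (fun t ↦ m t * m t) (fun t ↦ ε ^ 2 * m t) a (hm.mul hm).continuousOn
        (mul_eq_zero_of_left hm0 _) (hm.const_mul _).continuousOn (mul_eq_zero_of_right _ hm0),
        cfcₙ_mul m m a hm.continuousOn hm0 hm.continuousOn hm0,
        cfcₙ_const_mul (ε ^ 2) m a hm.continuousOn hm0]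
    rw [h1, h2]
    refine cfcₙ_congr fun t _ ↦ ?_
    rw [mul_right_comm, hpp, hm_eq]
    rcases max_cases (t - ε ^ 2) 0 with ⟨h, -⟩ | ⟨h, -⟩ <;> rw [h] <;> ring
  have hle : r * r ≤ g * k * g := by
    have hdn : ‖d‖ ≤ ε ^ 2 := by
      rw [hd_def, CStarRing.norm_star_mul_self, ← sq]; gcongr
    have hr0 : 0 ≤ r := cfcₙ_nonneg fun t _ ↦ hm_nonneg t
    have h1 : g * d * g ≤ ‖d‖ • r := by
      have := CStarAlgebra.star_left_conjugate_le_norm_smul (a := g) hd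
      rwa [hg.star_eq, hgg] at this
    have h2 : ‖d‖ • r ≤ (ε ^ 2) • r := smul_le_smul_of_nonneg_right hdn hr0
    have h3 : g * k * g = r * r + (ε ^ 2) • r - g * d * g := by
      rw [← hgag, hk_def]; noncomm_ring
    rw [h3, le_sub_iff_add_le]
    gcongr
    exact h1.trans h2
  have hrrS : r * r ∈ S :=
    mul_self_mem_of_le hS hrsa (hr _ hgB _ (hl _ hgB _ hkS)) hle
      fun x hx ↦ hr _ hrB _ (hl _ hrB _ hx)
  set q := cfcₙ l a with hq_def
  have hqB : q ∈ B := cfcₙ_mem_of_isClosed hB _ haB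
  have hqr : q * (r * r) = cfcₙ (fun t ↦ l t * (m t * m t)) a := by
    rw [cfcₙ_mul l (fun t ↦ m t * m t) a hlc.continuousOn hl0 (hm.mul hm).continuousOn
      (mul_eq_zero_of_left hm0 _), cfcₙ_mul m m a hm.continuousOn hm0 hm.continuousOn hm0]
  refine ⟨y * (q * (r * r)), mul_mem hy (mul_mem hqB (mul_mem hrB hrB)),
    hl _ hy _ (hl _ hqB _ hrrS), ?_⟩
  rw [hqr]
  refine norm_sub_mul_cfcₙ_star_mul_self_le y (by fun_prop) (by simp [hl0]) (by positivity)
    fun t ht ↦ ?_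
  rcases le_total t (ε ^ 2) with hte | hte
  · rw [hm_eq, max_eq_right (sub_nonpos.2 hte)]
    nlinarith
  · rw [hl_eq t hte, hm_eq, max_eq_left (sub_nonneg.2 hte)]
    have ht' : 0 < t := lt_of_lt_of_le (by positivity) hte
    have h1 : t * (1 - t / t ^ 3 * ((t - ε ^ 2) * (t - ε ^ 2))) ^ 2 =
        (ε ^ 2 * (2 * t - ε ^ 2)) ^ 2 / t ^ 3 := by
      field_simp
      ring
    rw [h1, div_le_iff₀ (by positivity)]
    have h2 : (2 * t - ε ^ 2) ^ 2 ≤ (2 * t) ^ 2 := by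
      apply pow_le_pow_left₀ <;> nlinarith
    calc (ε ^ 2 * (2 * t - ε ^ 2)) ^ 2 = ε ^ 2 * ε ^ 2 * (2 * t - ε ^ 2) ^ 2 := by ring
      _ ≤ ε ^ 2 * t * (2 * t) ^ 2 := by gcongr
      _ = (2 * ε) ^ 2 * t ^ 3 := by ring

/-- Closed two-sided ideals are self-adjoint. -/
theorem star_mem_of_isClosed_ideal {I : Submodule ℂ E} (hI : IsClosed (I : Set E))
    (hideal : ∀ a : E, ∀ x ∈ I, a * x ∈ I ∧ x * a ∈ I) {w : E} (hw : w ∈ I) : star w ∈ I := by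
  let D : NonUnitalStarSubalgebra ℂ E :=
    { carrier := {x | x ∈ I ∧ star x ∈ I}
      add_mem' := fun ha hb ↦ ⟨add_mem ha.1 hb.1, by rw [star_add]; exact add_mem ha.2 hb.2⟩
      zero_mem' := by simp
      mul_mem' := fun ha hb ↦ ⟨(hideal _ _ hb.1).1, by rw [star_mul]; exact (hideal _ _ ha.2).1⟩
      smul_mem' := fun c x hx ↦
        ⟨I.smul_mem c hx.1, by rw [star_smul]; exact I.smul_mem _ hx.2⟩
      star_mem' := fun ha ↦ ⟨ha.2, by rw [star_star]; exact ha.1⟩ }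
  have hD : IsClosed (D : Set E) := hI.inter (hI.preimage continuous_star)
  have hwD : star (star w) * star w ∈ D := by
    rw [star_star]
    exact ⟨(hideal _ _ hw).2, by rw [star_mul, star_star]; exact (hideal _ _ hw).2⟩
  rw [← SetLike.mem_coe, ← hI.closure_eq, Metric.mem_closure_iff]
  intro η hη
  have hδ : 0 < (η / 2) ^ 2 := by positivity
  refine ⟨star w * cfcₙ (fun t : ℝ ↦ t / (|t| + (η / 2) ^ 2)) (star (star w) * star w),
    (hideal _ _ (cfcₙ_mem_of_isClosed hD _ hwD).1).1, ?_⟩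
  rw [dist_eq_norm]
  refine (norm_sub_mul_cfcₙ_star_mul_self_le (star w) (continuous_div_abs_add hδ) (by simp)
    (by positivity) fun t ht ↦ mul_one_sub_div_abs_add_sq_le hδ ht).trans_lt (half_lt_self hη)

end FunctionalCalculus

theorem Submodule.isClosed_sup_of_norm_le {E : Type*} [NormedAddCommGroup E] [NormedSpace ℂ E]
    [CompleteSpace E] {P Q : Submodule ℂ E} (hP : IsClosed (P : Set E))
    (hQ : IsClosed (Q : Set E)) {C : ℝ} (hC : 0 ≤ C)
    (h : ∀ p ∈ P, ∀ q ∈ Q, ‖p‖ ≤ C * ‖p + q‖) : IsClosed ((P ⊔ Q : Submodule ℂ E) : Set E) := by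
  have : CompleteSpace P := hP.completeSpace_coe
  have : CompleteSpace Q := hQ.completeSpace_coe
  let f : P × Q →L[ℂ] E := P.subtypeL.coprod Q.subtypeL
  have hf : AntilipschitzWith ⟨C + 1, by positivity⟩ f := by
    refine AddMonoidHomClass.antilipschitz_of_bound f fun x ↦ ?_
    have h1 : ‖(x.1 : E)‖ ≤ C * ‖f x‖ := h x.1 x.1.2 x.2 x.2.2
    have h2 : ‖(x.2 : E)‖ ≤ ‖f x‖ + ‖(x.1 : E)‖ := by
      have : (x.2 : E) = f x - x.1 := by simp [f]
      rw [this]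
      exact norm_sub_le _ _
    have h3 := norm_nonneg (f x)
    rw [Prod.norm_def]
    change max ‖(x.1 : E)‖ ‖(x.2 : E)‖ ≤ (C + 1) * ‖f x‖
    exact max_le (by linarith) (by linarith)
  convert hf.isClosed_range f.uniformContinuous
  ext x
  simp [f, Submodule.mem_sup]

section Graded

variable {𝓛 : Type*} {E : Type*} [NonUnitalCStarAlgebra E]

/-- The sum of finitely many components of a family of star subalgebras. -/
def gradedSum (A : 𝓛 → NonUnitalStarSubalgebra ℂ E) (F : Finset 𝓛) : Submodule ℂ E :=
  ⨆ i ∈ F, (A i).toSubmodule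

variable {A : 𝓛 → NonUnitalStarSubalgebra ℂ E}

theorem mem_gradedSum_iff {F : Finset 𝓛} {x : E} :
    x ∈ gradedSum A F ↔ ∃ f : 𝓛 → E, (∀ i, f i ∈ A i) ∧ ∑ i ∈ F, f i = x := by
  rw [gradedSum, Submodule.mem_iSup_finset_iff_exists_sum]
  exact ⟨fun ⟨μ, h⟩ ↦ ⟨fun i ↦ μ i, fun i ↦ (μ i).2, h⟩, fun ⟨f, hf, h⟩ ↦ ⟨fun i ↦ ⟨f i, hf i⟩, h⟩⟩

theorem mem_gradedSum_of_mem {F : Finset 𝓛} {i : 𝓛} (hi : i ∈ F) {x : E} (hx : x ∈ A i) :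
    x ∈ gradedSum A F :=
  Submodule.mem_iSup_of_mem i (Submodule.mem_iSup_of_mem hi hx)

theorem gradedSum_mono {F G : Finset 𝓛} (h : F ⊆ G) : gradedSum A F ≤ gradedSum A G :=
  biSup_mono fun _ hi ↦ h hi

theorem star_mem_gradedSum {F : Finset 𝓛} {x : E} (hx : x ∈ gradedSum A F) :
    star x ∈ gradedSum A F := by
  obtain ⟨f, hf, rfl⟩ := mem_gradedSum_iff.1 hx
  rw [star_sum]
  exact sum_mem fun i hi ↦ mem_gradedSum_of_mem hi (star_mem (hf i))

theorem disjoint_gradedSum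
    (hindep : ∀ (s : Finset 𝓛) (x : 𝓛 → E), (∀ i, x i ∈ A i) →
      ∑ i ∈ s, x i = 0 → ∀ i ∈ s, x i = 0)
    {F G : Finset 𝓛} (hFG : Disjoint F G) {x : E} (hF : x ∈ gradedSum A F)
    (hG : x ∈ gradedSum A G) : x = 0 := by
  classical
  obtain ⟨f, hf, rfl⟩ := mem_gradedSum_iff.1 hF
  obtain ⟨g, hg, hgf⟩ := mem_gradedSum_iff.1 hG
  have hsum : ∑ i ∈ F ∪ G, (if i ∈ F then f i else -g i) = 0 := by
    rw [Finset.sum_union hFG, Finset.sum_congr rfl fun i hi ↦ if_pos hi,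
      Finset.sum_congr (s₁ := G) rfl fun i hi ↦ if_neg (Finset.disjoint_right.1 hFG hi),
      Finset.sum_neg_distrib, hgf, add_neg_cancel]
  have hmem : ∀ i, (if i ∈ F then f i else -g i) ∈ A i := fun i ↦ by
    split_ifs
    exacts [hf i, neg_mem (hg i)]
  refine Finset.sum_eq_zero fun i hi ↦ ?_
  simpa [hi] using hindep _ _ hmem hsum i (Finset.mem_union_left _ hi)

theorem exists_sum_eq_of_mem_span_iUnion {P : 𝓛 → Submodule ℂ E} {x : E}
    (hx : x ∈ Submodule.span ℂ (⋃ i, (P i : Set E))) :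
    ∃ (s : Finset 𝓛) (f : 𝓛 → E), (∀ i, f i ∈ P i) ∧ (∀ i ∉ s, f i = 0) ∧ ∑ i ∈ s, f i = x := by
  rw [← Submodule.iSup_eq_span, Submodule.mem_iSup_iff_exists_finsupp] at hx
  obtain ⟨f, hf, hfx⟩ := hx
  exact ⟨f.support, f, hf, fun i ↦ Finsupp.notMem_support_iff.1, hfx⟩

variable [SemilatticeInf 𝓛]

theorem mul_mem_gradedSum (hmul : ∀ i j : 𝓛, ∀ x ∈ A i, ∀ y ∈ A j, x * y ∈ A (i ⊓ j))
    {F G H : Finset 𝓛} (h : ∀ i ∈ F, ∀ j ∈ G, i ⊓ j ∈ H) {x y : E}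
    (hx : x ∈ gradedSum A F) (hy : y ∈ gradedSum A G) : x * y ∈ gradedSum A H := by
  obtain ⟨f, hf, rfl⟩ := mem_gradedSum_iff.1 hx
  obtain ⟨g, hg, rfl⟩ := mem_gradedSum_iff.1 hy
  rw [Finset.sum_mul_sum]
  exact sum_mem fun i hi ↦ sum_mem fun j hj ↦
    mem_gradedSum_of_mem (h i hi j hj) (hmul i j _ (hf i) _ (hg j))

/-- The sum of the components indexed by a finite subsemilattice, as a star subalgebra. -/
def gradedSumStarSubalgebra (hmul : ∀ i j : 𝓛, ∀ x ∈ A i, ∀ y ∈ A j, x * y ∈ A (i ⊓ j))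
    {F : Finset 𝓛} (hF : InfClosed (F : Set 𝓛)) : NonUnitalStarSubalgebra ℂ E :=
  { gradedSum A F with
    mul_mem' := mul_mem_gradedSum hmul fun _ hi _ hj ↦ hF hi hj
    star_mem' := star_mem_gradedSum }

theorem norm_le_two_mul_norm_sub_of_gradedSum
    (hindep : ∀ (s : Finset 𝓛) (x : 𝓛 → E), (∀ i, x i ∈ A i) →
      ∑ i ∈ s, x i = 0 → ∀ i ∈ s, x i = 0)
    (hmul : ∀ i j : 𝓛, ∀ x ∈ A i, ∀ y ∈ A j, x * y ∈ A (i ⊓ j))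
    {F G : Finset 𝓛} (hFG : Disjoint F G) (hF : InfClosed (F : Set 𝓛))
    (hG : InfClosed (G : Set 𝓛)) (hFGinf : ∀ i ∈ F, ∀ j ∈ G, i ⊓ j ∈ G)
    (hFc : IsClosed (gradedSum A F : Set E)) (hGc : IsClosed (gradedSum A G : Set E))
    {x w : E} (hx : x ∈ gradedSum A F) (hw : w ∈ gradedSum A G) : ‖x‖ ≤ 2 * ‖x - w‖ := by
  let _ := CStarAlgebra.spectralOrder E
  have _ := CStarAlgebra.spectralOrderedRing E
  refine le_of_forall_gt_imp_ge_of_dense fun c hc ↦ ?_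
  have hcpos : 0 < c / 2 := by linarith [norm_nonneg (x - w)]
  obtain ⟨z, hzF, hzG, hz⟩ := exists_mem_inf_norm_sub_le
    (B := gradedSumStarSubalgebra hmul hF) (S := gradedSumStarSubalgebra hmul hG) hFc hGc
    (fun b hb y hy ↦ mul_mem_gradedSum hmul hFGinf hb hy)
    (fun b hb y hy ↦ mul_mem_gradedSum hmul
      (fun i hi j hj ↦ by rw [inf_comm]; exact hFGinf j hj i hi) hy hb)
    hx hw hcpos (by linarith)
  have hz0 : z = 0 := disjoint_gradedSum hindep hFG hzF hzG
  rw [hz0, sub_zero] at hz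
  linarith

theorem isClosed_gradedSum (hclosed : ∀ i : 𝓛, IsClosed (A i : Set E))
    (hindep : ∀ (s : Finset 𝓛) (x : 𝓛 → E), (∀ i, x i ∈ A i) →
      ∑ i ∈ s, x i = 0 → ∀ i ∈ s, x i = 0)
    (hmul : ∀ i j : 𝓛, ∀ x ∈ A i, ∀ y ∈ A j, x * y ∈ A (i ⊓ j))
    (F : Finset 𝓛) (hF : InfClosed (F : Set 𝓛)) : IsClosed (gradedSum A F : Set E) := by
  classical
  induction F using Finset.strongInduction with
  | H F ih =>
    obtain rfl | hne := F.eq_empty_or_nonempty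
    · simp [gradedSum]
    obtain ⟨i, hi, hmax⟩ := F.exists_maximal hne
    have herase : ∀ a ∈ F, ∀ b ∈ F.erase i, a ⊓ b ∈ F.erase i := fun a ha b hb ↦ by
      rw [Finset.mem_erase] at hb ⊢
      refine ⟨fun hab ↦ hb.1 ?_, hF ha hb.2⟩
      have hib : i ≤ b := hab ▸ inf_le_right
      exact le_antisymm (hmax hb.2 hib) hib
    have hG : InfClosed (F.erase i : Set 𝓛) := fun a ha b hb ↦
      herase a (Finset.mem_of_mem_erase ha) b hb
    have hGc := ih _ (Finset.erase_ssubset hi) hG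
    have hsingle : gradedSum A {i} = (A i).toSubmodule := by simp [gradedSum]
    have hic : IsClosed (gradedSum A {i} : Set E) := by
      rw [hsingle]; exact hclosed i
    have hsup : gradedSum A F = gradedSum A {i} ⊔ gradedSum A (F.erase i) := by
      conv_lhs => rw [← Finset.insert_erase hi]
      rw [hsingle, gradedSum, Finset.iSup_insert]
      rfl
    rw [hsup]
    refine Submodule.isClosed_sup_of_norm_le hic hGc zero_le_two fun p hp q hq ↦ ?_
    rw [← sub_neg_eq_add]
    refine norm_le_two_mul_norm_sub_of_gradedSum hindep hmul (by simp) (by simp) hG ?_ hic hGc hp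
      (neg_mem hq)
    intro a ha b hb
    rw [Finset.mem_singleton.1 ha]
    exact herase i hi b hb

/-- The components above a fixed index can be projected onto with norm control. -/
theorem norm_sum_filter_le (hclosed : ∀ i : 𝓛, IsClosed (A i : Set E))
    (hindep : ∀ (s : Finset 𝓛) (x : 𝓛 → E), (∀ i, x i ∈ A i) →
      ∑ i ∈ s, x i = 0 → ∀ i ∈ s, x i = 0)
    (hmul : ∀ i j : 𝓛, ∀ x ∈ A i, ∀ y ∈ A j, x * y ∈ A (i ⊓ j))
    {F : Finset 𝓛} (hF : InfClosed (F : Set 𝓛)) (i : 𝓛) [DecidablePred (i ≤ ·)]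
    {x : 𝓛 → E} (hx : ∀ j, x j ∈ A j) :
    ‖∑ j ∈ F with i ≤ j, x j‖ ≤ 2 * ‖∑ j ∈ F, x j‖ := by
  have h1 : InfClosed ((F.filter (i ≤ ·) : Finset 𝓛) : Set 𝓛) := fun a ha b hb ↦ by
    simp only [Finset.coe_filter, Set.mem_ofPred_eq] at ha hb ⊢
    exact ⟨hF ha.1 hb.1, le_inf ha.2 hb.2⟩
  have h3 : ∀ a ∈ F, ∀ b ∈ F.filter (¬ i ≤ ·), a ⊓ b ∈ F.filter (¬ i ≤ ·) := fun a ha b hb ↦ by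
    rw [Finset.mem_filter] at hb ⊢
    exact ⟨hF ha hb.1, fun h ↦ hb.2 (h.trans inf_le_right)⟩
  have h2 : InfClosed ((F.filter (¬ i ≤ ·) : Finset 𝓛) : Set 𝓛) := fun a ha b hb ↦
    h3 a (Finset.mem_filter.1 ha).1 b hb
  rw [← Finset.sum_filter_add_sum_filter_not F (i ≤ ·) x, ← sub_neg_eq_add]
  exact norm_le_two_mul_norm_sub_of_gradedSum hindep hmul (Finset.disjoint_filter_filter_not ..)
    h1 h2 (fun a ha b hb ↦ h3 a (Finset.mem_filter.1 ha).1 b hb)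
    (isClosed_gradedSum hclosed hindep hmul _ h1) (isClosed_gradedSum hclosed hindep hmul _ h2)
    (mem_gradedSum_iff.2 ⟨x, hx, rfl⟩) (neg_mem (mem_gradedSum_iff.2 ⟨x, hx, rfl⟩))

theorem exists_finset_infClosed_superset (s : Finset 𝓛) :
    ∃ F : Finset 𝓛, s ⊆ F ∧ InfClosed (F : Set 𝓛) :=
  ⟨s.finite_toSet.infClosure.toFinset, fun i hi ↦ by simpa using subset_infClosure hi, by simp⟩

theorem mem_of_isMax_of_mem_closure_span (hclosed : ∀ i : 𝓛, IsClosed (A i : Set E))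
    (hindep : ∀ (s : Finset 𝓛) (x : 𝓛 → E), (∀ i, x i ∈ A i) →
      ∑ i ∈ s, x i = 0 → ∀ i ∈ s, x i = 0)
    (hmul : ∀ i j : 𝓛, ∀ x ∈ A i, ∀ y ∈ A j, x * y ∈ A (i ⊓ j))
    {I : Submodule ℂ E} (hI : IsClosed (I : Set E)) {s : Finset 𝓛} {x : 𝓛 → E}
    (hx : ∀ i, x i ∈ A i)
    (hxI : ∑ i ∈ s, x i ∈ closure
      (Submodule.span ℂ (⋃ i : 𝓛, (I : Set E) ∩ (A i : Set E)) : Set E))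
    {i : 𝓛} (hi : Maximal (· ∈ s) i) : x i ∈ I := by
  classical
  rw [← SetLike.mem_coe, ← hI.closure_eq, Metric.mem_closure_iff]
  intro ε hε
  obtain ⟨y, hy, hxy⟩ := Metric.mem_closure_iff.1 hxI (ε / 2) (half_pos hε)
  obtain ⟨t, f, hf, hft, rfl⟩ :=
    exists_sum_eq_of_mem_span_iUnion (P := fun i ↦ I ⊓ (A i).toSubmodule) hy
  obtain ⟨F, hsF, hF⟩ := exists_finset_infClosed_superset (s ∪ t)
  have hsF' : s ⊆ F := Finset.subset_union_left.trans hsF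
  have htF' : t ⊆ F := Finset.subset_union_right.trans hsF
  set x' : 𝓛 → E := fun j ↦ if j ∈ s then x j else 0 with hx'_def
  have hx' : ∀ j, x' j ∈ A j := fun j ↦ by
    simp only [hx'_def]
    split_ifs
    exacts [hx j, zero_mem _]
  have hsumx : ∑ j ∈ F, x' j = ∑ j ∈ s, x j := by
    rw [← Finset.sum_subset hsF' fun j _ hj ↦ if_neg hj]
    exact Finset.sum_congr rfl fun j hj ↦ if_pos hj
  have hsumf : ∑ j ∈ F, f j = ∑ j ∈ t, f j :=
    (Finset.sum_subset htF' fun j _ hj ↦ hft j hj).symm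
  have hfilter : ∑ j ∈ F with i ≤ j, x' j = x i := by
    rw [Finset.sum_eq_single i]
    · exact if_pos hi.prop
    · intro j hj hji
      refine if_neg fun hjs ↦ hji ?_
      have hij := (Finset.mem_filter.1 hj).2
      exact le_antisymm (hi.2 hjs hij) hij
    · intro h
      exact absurd (Finset.mem_filter.2 ⟨hsF' hi.prop, le_rfl⟩) h
  refine ⟨∑ j ∈ F with i ≤ j, f j, sum_mem fun j _ ↦ (hf j).1, ?_⟩
  have key := norm_sum_filter_le hclosed hindep hmul hF i (x := fun j ↦ x' j - f j)
    fun j ↦ sub_mem (hx' j) (hf j).2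
  rw [Finset.sum_sub_distrib, Finset.sum_sub_distrib, hfilter, hsumx, hsumf] at key
  rw [dist_eq_norm] at hxy ⊢
  linarith

theorem forall_mem_of_sum_mem_of_eq_closure_span (hclosed : ∀ i : 𝓛, IsClosed (A i : Set E))
    (hindep : ∀ (s : Finset 𝓛) (x : 𝓛 → E), (∀ i, x i ∈ A i) →
      ∑ i ∈ s, x i = 0 → ∀ i ∈ s, x i = 0)
    (hmul : ∀ i j : 𝓛, ∀ x ∈ A i, ∀ y ∈ A j, x * y ∈ A (i ⊓ j))
    {I : Submodule ℂ E} (hI : IsClosed (I : Set E))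
    (h : (I : Set E) = closure
      (Submodule.span ℂ (⋃ i : 𝓛, (I : Set E) ∩ (A i : Set E)) : Set E))
    (s : Finset 𝓛) {x : 𝓛 → E} (hx : ∀ i, x i ∈ A i) (hxI : ∑ i ∈ s, x i ∈ I) :
    ∀ i ∈ s, x i ∈ I := by
  classical
  induction s using Finset.strongInduction with
  | H s ih =>
    intro j hj
    obtain ⟨i, hi⟩ := s.exists_maximal ⟨j, hj⟩
    have hiI : x i ∈ I := mem_of_isMax_of_mem_closure_span hclosed hindep hmul hI hx
      (by rwa [← h]) hi
    obtain rfl | hji := eq_or_ne j i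
    · exact hiI
    refine ih _ (Finset.erase_ssubset hi.prop) ?_ j (Finset.mem_erase.2 ⟨hji, hj⟩)
    rw [Finset.sum_erase_eq_sub hi.prop]
    exact sub_mem hxI hiI

theorem eq_closure_span_of_forall_mem_of_sum_mem (hclosed : ∀ i : 𝓛, IsClosed (A i : Set E))
    (hindep : ∀ (s : Finset 𝓛) (x : 𝓛 → E), (∀ i, x i ∈ A i) →
      ∑ i ∈ s, x i = 0 → ∀ i ∈ s, x i = 0)
    (htotal : closure (Submodule.span ℂ (⋃ i : 𝓛, (A i : Set E)) : Set E) = Set.univ)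
    (hmul : ∀ i j : 𝓛, ∀ x ∈ A i, ∀ y ∈ A j, x * y ∈ A (i ⊓ j))
    {I : Submodule ℂ E} (hI : IsClosed (I : Set E))
    (hideal : ∀ a : E, ∀ x ∈ I, a * x ∈ I ∧ x * a ∈ I)
    (h : ∀ (s : Finset 𝓛) (x : 𝓛 → E), (∀ i, x i ∈ A i) →
      ∑ i ∈ s, x i ∈ I → ∀ i ∈ s, x i ∈ I) :
    (I : Set E) = closure
      (Submodule.span ℂ (⋃ i : 𝓛, (I : Set E) ∩ (A i : Set E)) : Set E) := by
  let _ := CStarAlgebra.spectralOrder E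
  have _ := CStarAlgebra.spectralOrderedRing E
  refine subset_antisymm (fun x hx ↦ ?_) (closure_minimal ?_ hI)
  · let S : NonUnitalStarSubalgebra ℂ E :=
      { I with
        mul_mem' := fun _ hb ↦ (hideal _ _ hb).1
        star_mem' := star_mem_of_isClosed_ideal hI hideal }
    rw [Metric.mem_closure_iff]
    intro ε hε
    obtain ⟨y, hy, hxy⟩ := Metric.mem_closure_iff.1 (htotal ▸ Set.mem_univ x) (ε / 4)
      (by positivity)
    obtain ⟨t, f, hf, -, rfl⟩ := exists_sum_eq_of_mem_span_iUnion (P := fun i ↦ (A i).toSubmodule) hy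
    obtain ⟨F, htF, hF⟩ := exists_finset_infClosed_superset t
    rw [dist_comm, dist_eq_norm] at hxy
    obtain ⟨z, hzF, hzI, hz⟩ := exists_mem_inf_norm_sub_le
      (B := gradedSumStarSubalgebra hmul hF) (S := S)
      (isClosed_gradedSum hclosed hindep hmul F hF) hI
      (fun b _ x hx ↦ (hideal b x hx).1) (fun b _ x hx ↦ (hideal b x hx).2)
      (gradedSum_mono htF (mem_gradedSum_iff.2 ⟨f, hf, rfl⟩)) (w := x) hx
      (by positivity) hxy.le
    obtain ⟨g, hg, rfl⟩ := mem_gradedSum_iff.1 hzF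
    refine ⟨∑ i ∈ F, g i, sum_mem fun i hi ↦ Submodule.subset_span ?_, ?_⟩
    · exact Set.mem_iUnion.2 ⟨i, h F g hg hzI i hi, hg i⟩
    · rw [dist_eq_norm]
      have := norm_sub_le_norm_sub_add_norm_sub x (∑ i ∈ t, f i) (∑ i ∈ F, g i)
      rw [norm_sub_rev x (∑ i ∈ t, f i)] at this
      linarith
  · exact Submodule.span_le.2 (Set.iUnion_subset fun i ↦ Set.inter_subset_left)

end Graded

theorem stmt_13
    {𝓛 : Type*} [SemilatticeInf 𝓛]
    {𝔄 : Type*} [NonUnitalNormedRing 𝔄] [StarRing 𝔄] [CStarRing 𝔄]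
    [NormedSpace ℂ 𝔄] [IsScalarTower ℂ 𝔄 𝔄] [SMulCommClass ℂ 𝔄 𝔄]
    [StarModule ℂ 𝔄] [CompleteSpace 𝔄]
    (A : 𝓛 → NonUnitalStarSubalgebra ℂ 𝔄)
    (hA_closed : ∀ i : 𝓛, IsClosed ((A i : Set 𝔄)))
    (hA_indep : ∀ (s : Finset 𝓛) (x : 𝓛 → 𝔄), (∀ i, x i ∈ A i) →
        ∑ i ∈ s, x i = 0 → ∀ i ∈ s, x i = 0)
    (hA_total : closure ((Submodule.span ℂ (⋃ i : 𝓛, (A i : Set 𝔄)) : Submodule ℂ 𝔄) : Set 𝔄) = Set.univ)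
    (hA_mul : ∀ i j : 𝓛, ∀ x ∈ A i, ∀ y ∈ A j, x * y ∈ A (i ⊓ j))
    (I : Submodule ℂ 𝔄) (hI_closed : IsClosed (I : Set 𝔄))
    (hI_ideal : ∀ a : 𝔄, ∀ x ∈ I, a * x ∈ I ∧ x * a ∈ I) :
    ((I : Set 𝔄) = closure ((Submodule.span ℂ
        (⋃ i : 𝓛, (I : Set 𝔄) ∩ (A i : Set 𝔄)) : Submodule ℂ 𝔄) : Set 𝔄)) ↔
    (∀ (s : Finset 𝓛) (x : 𝓛 → 𝔄), (∀ i, x i ∈ A i) →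
        (∑ i ∈ s, x i) ∈ I → ∀ i ∈ s, x i ∈ I) := by
  let _ : NonUnitalCStarAlgebra 𝔄 := {}
  exact ⟨fun h s x hx hxI ↦
      forall_mem_of_sum_mem_of_eq_closure_span hA_closed hA_indep hA_mul hI_closed h s hx hxI,
    fun h ↦ eq_closure_span_of_forall_mem_of_sum_mem hA_closed hA_indep hA_total hA_mul hI_closed
      hI_ideal h⟩
end
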